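/- arXiv:2310.19847 — 2 statements merged into one kernel-verified Lean document; each statement's English description precedes it below -/
import Mathlib

section
/- ∫₀^∞ tanh(z)⁶/z⁶ dz = 5842 ζ(7)/(5π⁶) - 57232 ζ(9)/π⁸ + 515844 ζ(11)/π¹⁰. -/
open Real MeasureTheory

open Set Filter Topology Asymptotics

/-- The series `∑ 1 / (n ^ (2 * k) * (y ^ 2 + n ^ 2))` over positive integers `n`
(for `0 < k` the term at `n = 0` is zero). -/
noncomputable def zetaTail (k : ℕ) (y : ℝ) : ℝ :=
  ∑' n : ℕ, 1 / ((n : ℝ) ^ (2 * k) * (y ^ 2 + (n : ℝ) ^ 2))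

lemma summable_one_div_nat_pow_two_mul {k : ℕ} (hk : 0 < k) :
    Summable fun n : ℕ ↦ 1 / (n : ℝ) ^ (2 * k) :=
  Real.summable_one_div_nat_pow.2 (by lia)

lemma zetaTail_term_le {k : ℕ} (hk : 0 < k) (n : ℕ) (y : ℝ) :
    1 / ((n : ℝ) ^ (2 * k) * (y ^ 2 + (n : ℝ) ^ 2)) ≤ 1 / (n : ℝ) ^ (2 * k) * (1 + y ^ 2)⁻¹ := by
  rcases Nat.eq_zero_or_pos n with rfl | hn
  · simp [hk.ne']
  · have h1 : (1 : ℝ) ≤ n := by exact_mod_cast hn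
    rw [one_div, one_div, mul_inv, add_comm (y ^ 2)]
    gcongr
    exact one_le_pow₀ h1

lemma summable_zetaTail {k : ℕ} (hk : 0 < k) (y : ℝ) :
    Summable fun n : ℕ ↦ 1 / ((n : ℝ) ^ (2 * k) * (y ^ 2 + (n : ℝ) ^ 2)) :=
  .of_nonneg_of_le (fun n ↦ by positivity) (fun n ↦ zetaTail_term_le hk n y)
    ((summable_one_div_nat_pow_two_mul hk).mul_right _)

lemma zetaTail_nonneg (k : ℕ) (y : ℝ) : 0 ≤ zetaTail k y :=
  tsum_nonneg fun n ↦ by positivity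

lemma zetaTail_le {k : ℕ} (hk : 0 < k) (y : ℝ) :
    zetaTail k y ≤ (∑' n : ℕ, 1 / (n : ℝ) ^ (2 * k)) * (1 + y ^ 2)⁻¹ := by
  rw [← tsum_mul_right]
  exact (summable_zetaTail hk y).tsum_le_tsum (zetaTail_term_le hk · y)
    ((summable_one_div_nat_pow_two_mul hk).mul_right _)

lemma zetaTail_eq_sub {k : ℕ} (hk : 0 < k) (y : ℝ) :
    zetaTail k y = (∑' n : ℕ, 1 / (n : ℝ) ^ (2 * (k + 1))) - y ^ 2 * zetaTail (k + 1) y := by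
  rw [zetaTail, zetaTail, ← tsum_mul_left, ← (summable_one_div_nat_pow_two_mul k.succ_pos).tsum_sub
    ((summable_zetaTail k.succ_pos y).mul_left _)]
  congr 1 with n
  rcases Nat.eq_zero_or_pos n with rfl | hn
  · simp [hk.ne']
  · have : (n : ℝ) ≠ 0 := by positivity
    have : y ^ 2 + (n : ℝ) ^ 2 ≠ 0 := by positivity
    rw [Nat.succ_eq_add_one, mul_add 2 k 1, mul_one, pow_add]
    field_simp
    ring

lemma integrableOn_zetaTail_term {k : ℕ} (hk : 0 < k) (n : ℕ) :
    IntegrableOn (fun y : ℝ ↦ 1 / ((n : ℝ) ^ (2 * k) * (y ^ 2 + (n : ℝ) ^ 2))) (Ioi 0) := by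
  refine ((integrable_inv_one_add_sq.const_mul (1 / (n : ℝ) ^ (2 * k))).mono'
    (Measurable.aestronglyMeasurable (by fun_prop)) (.of_forall fun y ↦ ?_)).integrableOn
  rw [norm_of_nonneg (by positivity)]
  exact zetaTail_term_le hk n y

lemma integral_zetaTail_term {k : ℕ} (hk : 0 < k) (n : ℕ) :
    ∫ y in Ioi (0 : ℝ), 1 / ((n : ℝ) ^ (2 * k) * (y ^ 2 + (n : ℝ) ^ 2)) =
      π / 2 * (1 / (n : ℝ) ^ (2 * k + 1)) := by
  rcases Nat.eq_zero_or_pos n with rfl | hn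
  · simp [hk.ne']
  · have hn : (0 : ℝ) < n := by positivity
    have h := integral_comp_mul_left_Ioi (fun x : ℝ ↦ (1 + x ^ 2)⁻¹) 0 (inv_pos.2 hn)
    rw [mul_zero, integral_Ioi_inv_one_add_sq, arctan_zero, sub_zero, inv_inv, smul_eq_mul] at h
    have h2 (y : ℝ) : 1 / ((n : ℝ) ^ (2 * k) * (y ^ 2 + (n : ℝ) ^ 2)) =
        1 / (n : ℝ) ^ (2 * k + 2) * (1 + ((n : ℝ)⁻¹ * y) ^ 2)⁻¹ := by
      have : y ^ 2 + (n : ℝ) ^ 2 ≠ 0 := by positivity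
      field_simp
      ring
    simp_rw [h2]
    rw [integral_const_mul, h]
    field_simp
    ring

lemma integral_zetaTail {k : ℕ} (hk : 0 < k) :
    ∫ y in Ioi (0 : ℝ), zetaTail k y = π / 2 * ∑' n : ℕ, 1 / (n : ℝ) ^ (2 * k + 1) := by
  have hs : Summable fun n : ℕ ↦ π / 2 * (1 / (n : ℝ) ^ (2 * k + 1)) :=
    (Real.summable_one_div_nat_pow.2 (by lia)).mul_left _
  have h := hasSum_integral_of_summable_integral_norm (integrableOn_zetaTail_term hk) (by
    refine hs.congr fun n ↦ ?_
    rw [← integral_zetaTail_term hk]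
    congr 1 with y
    exact (norm_of_nonneg (by positivity)).symm)
  simp_rw [integral_zetaTail_term hk] at h
  rw [← tsum_mul_left, h.tsum_eq]
  rfl

lemma continuous_zetaTail {k : ℕ} (hk : 0 < k) : Continuous (zetaTail k) := by
  refine continuous_tsum (fun n ↦ ?_) (summable_one_div_nat_pow_two_mul hk) fun n y ↦ ?_
  · rcases Nat.eq_zero_or_pos n with rfl | hn
    · simpa [hk.ne'] using continuous_const
    · have hn : (0 : ℝ) < n := by positivity
      exact continuous_const.div (by fun_prop) fun y ↦ by positivity
  · rw [norm_of_nonneg (by positivity)]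
    refine (zetaTail_term_le hk n y).trans (mul_le_of_le_one_right (by positivity) ?_)
    exact inv_le_one_of_one_le₀ (by nlinarith)

lemma integrableOn_zetaTail {k : ℕ} (hk : 0 < k) : IntegrableOn (zetaTail k) (Ioi 0) := by
  refine ((integrable_inv_one_add_sq.const_mul (∑' n : ℕ, 1 / (n : ℝ) ^ (2 * k))).mono'
    (continuous_zetaTail hk).aestronglyMeasurable (.of_forall fun y ↦ ?_)).integrableOn
  rw [norm_of_nonneg (zetaTail_nonneg k y)]
  exact zetaTail_le hk y

lemma pi_mul_coth_pi_mul_eq {y : ℝ} (hy : 0 < y) :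
    π * (cosh (π * y) / sinh (π * y)) = 1 / y + ∑' n : ℕ, 2 * y / (y ^ 2 + ((n : ℝ) + 1) ^ 2) := by
  have hI : (Complex.I * y : ℂ) ∈ Complex.integerComplement := by
    rintro ⟨m, hm⟩
    have := congrArg Complex.im hm
    simp at this
    exact hy.ne this
  have h := cot_series_rep' hI
  have hs : Complex.sinh (π * y) ≠ 0 := by
    rw [← Complex.ofReal_mul, ← Complex.ofReal_sinh]
    exact_mod_cast (sinh_pos_iff.2 (by positivity)).ne'
  have h1 : Complex.cot (π * (Complex.I * y)) =
      -Complex.I * (Complex.cosh (π * y) / Complex.sinh (π * y)) := by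
    rw [show (π * (Complex.I * y) : ℂ) = (π * y) * Complex.I by ring, Complex.cot,
      Complex.cos_mul_I, Complex.sin_mul_I]
    field_simp
    simp
  have h2 (n : ℕ) : (1 / (Complex.I * y - (n + 1)) + 1 / (Complex.I * y + (n + 1)) : ℂ) =
      -Complex.I * ((2 * y / (y ^ 2 + ((n : ℝ) + 1) ^ 2) : ℝ) : ℂ) := by
    have h3 : (Complex.I * y - (n + 1) : ℂ) ≠ 0 := fun h ↦ by
      simpa [hy.ne'] using congrArg Complex.im h
    have h4 : (Complex.I * y + (n + 1) : ℂ) ≠ 0 := fun h ↦ by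
      simpa [hy.ne'] using congrArg Complex.im h
    have h5 : (y ^ 2 + (n + 1) ^ 2 : ℂ) ≠ 0 := by
      have : y ^ 2 + (n + 1 : ℝ) ^ 2 ≠ 0 := by positivity
      exact_mod_cast this
    push_cast
    field_simp
    linear_combination (2 * Complex.I * y ^ 3) * Complex.I_sq
  rw [h1, tsum_congr h2, tsum_mul_left] at h
  have hI2 : (1 / (Complex.I * y) : ℂ) = -Complex.I * (1 / y) := by
    rw [one_div, mul_inv, Complex.inv_I, one_div]
  rw [hI2] at h
  have h' := mul_left_cancel₀ (neg_ne_zero.2 Complex.I_ne_zero)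
    (show -Complex.I * (π * (Complex.cosh (π * y) / Complex.sinh (π * y)) - 1 / y) = _ from
      Eq.trans (by ring) h)
  rw [← sub_eq_iff_eq_add']
  exact_mod_cast h'
lemma pi_mul_coth_pi_mul_eq_zetaTail {y : ℝ} (hy : 0 < y) :
    π * (cosh (π * y) / sinh (π * y)) =
      1 / y + 2 * y * (π ^ 2 / 6 - y ^ 2 * zetaTail 1 y) := by
  have h := (summable_zetaTail one_pos y).hasSum.mul_left (y ^ 2)
  have h2 := hasSum_zeta_two.sub h
  rw [← hasSum_nat_add_iff' 1] at h2
  have h3 := h2.mul_left (2 * y)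
  rw [pi_mul_coth_pi_mul_eq hy]
  simp only [Finset.range_one, Finset.sum_singleton, Nat.cast_zero, mul_one, ne_eq,
    OfNat.ofNat_ne_zero, not_false_eq_true, zero_pow, div_zero, zero_mul, mul_zero, sub_zero] at h3
  rw [zetaTail, ← h3.tsum_eq]
  congr 2 with n
  have : y ^ 2 + ((n : ℝ) + 1) ^ 2 ≠ 0 := by positivity
  push_cast
  field_simp
  ring

/-- Up to elementary factors, the remainder of the Taylor expansion of `tanh` at zero. -/
noncomputable def tanhTail (k : ℕ) (z : ℝ) : ℝ :=
  4 ^ (k + 1) * zetaTail k (2 / π * z) - zetaTail k (1 / π * z)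

lemma tanhTail_eq_sub {k : ℕ} (hk : 0 < k) (z : ℝ) :
    tanhTail k z = (4 ^ (k + 1) - 1) * (∑' n : ℕ, 1 / (n : ℝ) ^ (2 * (k + 1))) -
      z ^ 2 / π ^ 2 * tanhTail (k + 1) z := by
  rw [tanhTail, tanhTail, zetaTail_eq_sub hk, zetaTail_eq_sub hk (1 / π * z)]
  ring

lemma tanh_eq_tanhTail_one {z : ℝ} (hz : 0 < z) :
    tanh z = z - 2 * z ^ 3 / π ^ 4 * tanhTail 1 z := by
  have h1 := pi_mul_coth_pi_mul_eq_zetaTail (y := 1 / π * z) (by positivity)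
  have h2 := pi_mul_coth_pi_mul_eq_zetaTail (y := 2 / π * z) (by positivity)
  rw [show π * (1 / π * z) = z by field_simp] at h1
  rw [show π * (2 / π * z) = 2 * z by field_simp, sinh_two_mul, cosh_two_mul] at h2
  have hs : sinh z ≠ 0 := (sinh_pos_iff.2 hz).ne'
  have hc : cosh z ≠ 0 := (cosh_pos z).ne'
  have h3 : π * tanh z = 2 * (π * ((cosh z ^ 2 + sinh z ^ 2) / (2 * sinh z * cosh z))) -
      π * (cosh z / sinh z) := by
    rw [tanh_eq_sinh_div_cosh]
    field_simp
    ring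
  rw [h1, h2] at h3
  have h4 : tanh z = (π * tanh z) / π := by field_simp
  rw [h4, h3, tanhTail]
  field_simp
  ring

lemma bernoulli_six : bernoulli 6 = 1 / 42 := by
  rw [bernoulli_eq_bernoulli'_of_ne_one (by lia), bernoulli'_def]
  norm_num [Finset.sum_range_succ, Nat.choose, bernoulli'_eq_zero_of_odd (show Odd 5 by decide)]

lemma bernoulli_eight : bernoulli 8 = -1 / 30 := by
  rw [bernoulli_eq_bernoulli'_of_ne_one (by lia), bernoulli'_def]
  norm_num [Finset.sum_range_succ, Nat.choose, bernoulli'_eq_zero_of_odd (show Odd 5 by decide),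
    bernoulli'_eq_zero_of_odd (show Odd 7 by decide),
    ← bernoulli_eq_bernoulli'_of_ne_one (show 6 ≠ 1 by lia), bernoulli_six]

lemma bernoulli_ten : bernoulli 10 = 5 / 66 := by
  rw [bernoulli_eq_bernoulli'_of_ne_one (by lia), bernoulli'_def]
  norm_num [Finset.sum_range_succ, Nat.choose, bernoulli'_eq_zero_of_odd (show Odd 5 by decide),
    bernoulli'_eq_zero_of_odd (show Odd 7 by decide),
    bernoulli'_eq_zero_of_odd (show Odd 9 by decide),
    ← bernoulli_eq_bernoulli'_of_ne_one (show 6 ≠ 1 by lia), bernoulli_six,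
    ← bernoulli_eq_bernoulli'_of_ne_one (show 8 ≠ 1 by lia), bernoulli_eight]

lemma tsum_one_div_nat_pow_six : ∑' n : ℕ, 1 / (n : ℝ) ^ 6 = π ^ 6 / 945 := by
  have h := (hasSum_zeta_nat (k := 3) (by lia)).tsum_eq
  norm_num [bernoulli_six, Nat.factorial] at h ⊢
  rw [h]
  ring

lemma tsum_one_div_nat_pow_eight : ∑' n : ℕ, 1 / (n : ℝ) ^ 8 = π ^ 8 / 9450 := by
  have h := (hasSum_zeta_nat (k := 4) (by lia)).tsum_eq
  norm_num [bernoulli_eight, Nat.factorial] at h ⊢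
  rw [h]
  ring

lemma tsum_one_div_nat_pow_ten : ∑' n : ℕ, 1 / (n : ℝ) ^ 10 = π ^ 10 / 93555 := by
  have h := (hasSum_zeta_nat (k := 5) (by lia)).tsum_eq
  norm_num [bernoulli_ten, Nat.factorial] at h ⊢
  rw [h]
  ring

lemma tanh_eq_tanhTail_three {z : ℝ} (hz : 0 < z) :
    tanh z = z - z ^ 3 / 3 + 2 * z ^ 5 / 15 - 2 * z ^ 7 / π ^ 8 * tanhTail 3 z := by
  rw [tanh_eq_tanhTail_one hz, tanhTail_eq_sub one_pos,
    tanhTail_eq_sub (k := 1 + 1) (by lia),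
    show 2 * (1 + 1) = 4 by rfl, show 2 * (1 + 1 + 1) = 6 by rfl, hasSum_zeta_four.tsum_eq,
    tsum_one_div_nat_pow_six]
  field_simp
  ring

lemma tanh_eq_tanhTail_four {z : ℝ} (hz : 0 < z) :
    tanh z = z - z ^ 3 / 3 + 2 * z ^ 5 / 15 - 17 * z ^ 7 / 315 +
      2 * z ^ 9 / π ^ 10 * tanhTail 4 z := by
  rw [tanh_eq_tanhTail_three hz, tanhTail_eq_sub three_pos, show 2 * (3 + 1) = 8 by rfl,
    tsum_one_div_nat_pow_eight]
  field_simp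
  ring

lemma tanh_eq_tanhTail_five {z : ℝ} (hz : 0 < z) :
    tanh z = z - z ^ 3 / 3 + 2 * z ^ 5 / 15 - 17 * z ^ 7 / 315 + 62 * z ^ 9 / 2835 -
      2 * z ^ 11 / π ^ 12 * tanhTail 5 z := by
  rw [tanh_eq_tanhTail_four hz, tanhTail_eq_sub four_pos, show 2 * (4 + 1) = 10 by rfl,
    tsum_one_div_nat_pow_ten]
  field_simp
  ring

lemma integrableOn_tanhTail {k : ℕ} (hk : 0 < k) : IntegrableOn (tanhTail k) (Ioi 0) := by
  have h {c : ℝ} (hc : 0 < c) : IntegrableOn (fun z ↦ zetaTail k (c * z)) (Ioi 0) := by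
    rw [integrableOn_Ioi_comp_mul_left_iff _ _ hc, mul_zero]
    exact integrableOn_zetaTail hk
  exact ((h (by positivity)).const_mul _).sub (h (by positivity))

lemma integral_tanhTail {k : ℕ} (hk : 0 < k) :
    ∫ z in Ioi (0 : ℝ), tanhTail k z =
      π ^ 2 / 2 * (2 ^ (2 * k + 1) - 1) * ∑' n : ℕ, 1 / (n : ℝ) ^ (2 * k + 1) := by
  have h {c : ℝ} (hc : 0 < c) : IntegrableOn (fun z ↦ zetaTail k (c * z)) (Ioi 0) := by
    rw [integrableOn_Ioi_comp_mul_left_iff _ _ hc, mul_zero]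
    exact integrableOn_zetaTail hk
  simp only [tanhTail]
  rw [integral_sub ((h (by positivity)).const_mul _) (h (by positivity)), integral_const_mul,
    integral_comp_mul_left_Ioi _ _ (by positivity), integral_comp_mul_left_Ioi _ _ (by positivity),
    mul_zero, mul_zero, integral_zetaTail hk, smul_eq_mul, smul_eq_mul,
    show (4 : ℝ) = 2 ^ 2 by norm_num, ← pow_mul]
  field_simp
  ring

lemma continuous_tanhTail {k : ℕ} (hk : 0 < k) : Continuous (tanhTail k) := by
  have := continuous_zetaTail hk
  unfold tanhTail
  fun_prop

lemma hasDerivAt_tanh (x : ℝ) : HasDerivAt tanh (1 - tanh x ^ 2) x := by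
  have h := (hasDerivAt_sinh x).div (hasDerivAt_cosh x) (cosh_pos x).ne'
  have hc := (cosh_pos x).ne'
  refine (h.congr_of_eventuallyEq (.of_forall tanh_eq_sinh_div_cosh)).congr_deriv ?_
  rw [tanh_eq_sinh_div_cosh]
  field_simp

lemma continuous_real_tanh : Continuous tanh :=
  continuous_iff_continuousAt.2 fun x ↦ (hasDerivAt_tanh x).continuousAt

lemma tanh_nonneg_of_nonneg {x : ℝ} (hx : 0 ≤ x) : 0 ≤ tanh x := by
  rw [tanh_eq_sinh_div_cosh]
  exact div_nonneg (sinh_nonneg_iff.2 hx) (cosh_pos x).le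

lemma tanh_le_self {x : ℝ} (hx : 0 ≤ x) : tanh x ≤ x := by
  have hd (y : ℝ) : HasDerivAt (fun y ↦ y - tanh y) (tanh y ^ 2) y :=
    ((hasDerivAt_id y).sub (hasDerivAt_tanh y)).congr_deriv (by ring)
  have hm : Monotone fun y ↦ y - tanh y := monotone_of_deriv_nonneg
    (fun y ↦ (hd y).differentiableAt) fun y ↦ by rw [(hd y).deriv]; positivity
  simpa using hm hx

lemma integrableOn_tanh_pow_six_div :
    IntegrableOn (fun z ↦ tanh z ^ 6 / z ^ 6) (Ioi 0) := by
  have hmeas : Measurable tanh := continuous_real_tanh.measurable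
  refine ((integrable_inv_one_add_sq.const_mul 2).integrableOn).mono'
    (Measurable.aestronglyMeasurable (by fun_prop)) ?_
  filter_upwards [ae_restrict_mem measurableSet_Ioi] with z hz
  have hz : 0 < z := hz
  have h0 := tanh_nonneg_of_nonneg hz.le
  rw [norm_of_nonneg (by positivity), ← div_eq_mul_inv]
  rcases le_total z 1 with h1 | h1
  · calc tanh z ^ 6 / z ^ 6 ≤ 1 := div_le_one_of_le₀ (by gcongr; exact tanh_le_self hz.le)
          (by positivity)
      _ ≤ 2 / (1 + z ^ 2) := by rw [le_div_iff₀ (by positivity)]; nlinarith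
  · calc tanh z ^ 6 / z ^ 6 ≤ 1 / z ^ 6 := by gcongr; exact pow_le_one₀ h0 (tanh_lt_one z).le
      _ ≤ 1 / z ^ 2 := by gcongr; lia
      _ ≤ 2 / (1 + z ^ 2) := by
        rw [div_le_div_iff₀ (by positivity) (by positivity)]
        nlinarith

/-- A function whose derivative differs from `tanh z ^ 6 / z ^ 6` by a combination of the tails
`tanhTail 3`, `tanhTail 4` and `tanhTail 5`. -/
noncomputable def tanhPrimitive (z : ℝ) : ℝ :=
  -(1 / 5) * (tanh z ^ 5 / z ^ 6) + 3 / 10 * (tanh z ^ 4 / z ^ 7) -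
    tanh z ^ 3 / z ^ 6 / 3 - 7 / 10 * (tanh z ^ 3 / z ^ 8) +
    8 / 5 * (tanh z ^ 2 / z ^ 7) + 14 / 5 * (tanh z ^ 2 / z ^ 9) -
    tanh z / z ^ 6 - 133 / 10 * (tanh z / z ^ 8) - 126 / 5 * (tanh z / z ^ 10) +
    126 / 5 * (1 / z ^ 9) + 21 / 10 * (1 / z ^ 7) + 67 / 75 * (1 / z ^ 5) -
    26 / 45 * (1 / z ^ 3) + 52 / 75 * (1 / z)

lemma hasDerivAt_tanh_pow_div (a b : ℕ) {z : ℝ} (hz : z ≠ 0) :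
    HasDerivAt (fun z ↦ tanh z ^ a / z ^ b)
      (a * tanh z ^ (a - 1) * (1 - tanh z ^ 2) / z ^ b - b * tanh z ^ a / z ^ (b + 1)) z := by
  refine (((hasDerivAt_tanh z).pow a).div (hasDerivAt_pow b z) (pow_ne_zero b hz)).congr_deriv ?_
  rcases b with _ | b
  · simp
  · push_cast
    simp only [Pi.pow_apply]
    field_simp
    ring_nf

lemma hasDerivAt_tanhPrimitive {z : ℝ} (hz : 0 < z) :
    HasDerivAt tanhPrimitive (tanh z ^ 6 / z ^ 6 - 92 / 5 / π ^ 8 * tanhTail 3 z +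
      224 / π ^ 10 * tanhTail 4 z - 504 / π ^ 12 * tanhTail 5 z) z := by
  have h (a b : ℕ) := hasDerivAt_tanh_pow_div a b hz.ne'
  have h3 : 92 / 5 / π ^ 8 * tanhTail 3 z =
      -(46 / 5) * ((tanh z - (z - z ^ 3 / 3 + 2 * z ^ 5 / 15)) / z ^ 7) := by
    rw [tanh_eq_tanhTail_three hz]
    field_simp
    ring
  have h4 : 224 / π ^ 10 * tanhTail 4 z =
      112 * ((tanh z - (z - z ^ 3 / 3 + 2 * z ^ 5 / 15 - 17 * z ^ 7 / 315)) / z ^ 9) := by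
    rw [tanh_eq_tanhTail_four hz]
    field_simp
    ring
  have h5 : 504 / π ^ 12 * tanhTail 5 z =
      -252 * ((tanh z - (z - z ^ 3 / 3 + 2 * z ^ 5 / 15 - 17 * z ^ 7 / 315 + 62 * z ^ 9 / 2835)) /
        z ^ 11) := by
    rw [tanh_eq_tanhTail_five hz]
    field_simp
    ring
  rw [h3, h4, h5]
  have hd := (((((((((((((((h 5 6).const_mul (-(1 / 5))).add ((h 4 7).const_mul (3 / 10))).sub
    ((h 3 6).div_const 3)).sub ((h 3 8).const_mul (7 / 10))).add ((h 2 7).const_mul (8 / 5))).add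
    ((h 2 9).const_mul (14 / 5))).sub (h 1 6)).sub ((h 1 8).const_mul (133 / 10))).sub
    ((h 1 10).const_mul (126 / 5))).add ((h 0 9).const_mul (126 / 5))).add
    ((h 0 7).const_mul (21 / 10))).add ((h 0 5).const_mul (67 / 75))).sub
    ((h 0 3).const_mul (26 / 45))).add ((h 0 1).const_mul (52 / 75)))
  refine (hd.congr_of_eventuallyEq (.of_forall fun x ↦ ?_)).congr_deriv ?_
  · simp [tanhPrimitive]
  · generalize tanh z = t
    norm_num
    field_simp
    ring

lemma tendsto_tanhPrimitive_atTop : Tendsto tanhPrimitive atTop (𝓝 0) := by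
  have h (a b : ℕ) (hb : b ≠ 0) : Tendsto (fun z : ℝ ↦ tanh z ^ a / z ^ b) atTop (𝓝 0) := by
    refine squeeze_zero_norm (a := fun z ↦ ‖(z ^ b)⁻¹‖) (fun z ↦ ?_) ?_
    · rw [div_eq_mul_inv, norm_mul, norm_pow]
      have := pow_le_one₀ (n := a) (abs_nonneg (tanh z)) (abs_tanh_lt_one z).le
      exact mul_le_of_le_one_left (norm_nonneg _) this
    · simpa using ((tendsto_inv_atTop_zero (𝕜 := ℝ)).comp (tendsto_pow_atTop hb)).norm
  have hd := (((((((((((((((h 5 6 (by lia)).const_mul (-(1 / 5))).add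
    ((h 4 7 (by lia)).const_mul (3 / 10))).sub
    ((h 3 6 (by lia)).div_const 3)).sub ((h 3 8 (by lia)).const_mul (7 / 10))).add
    ((h 2 7 (by lia)).const_mul (8 / 5))).add
    ((h 2 9 (by lia)).const_mul (14 / 5))).sub (h 1 6 (by lia))).sub
    ((h 1 8 (by lia)).const_mul (133 / 10))).sub
    ((h 1 10 (by lia)).const_mul (126 / 5))).add ((h 0 9 (by lia)).const_mul (126 / 5))).add
    ((h 0 7 (by lia)).const_mul (21 / 10))).add ((h 0 5 (by lia)).const_mul (67 / 75))).sub
    ((h 0 3 (by lia)).const_mul (26 / 45))).add ((h 0 1 (by lia)).const_mul (52 / 75)))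
  refine (hd.congr fun z ↦ ?_).trans (by simp)
  simp [tanhPrimitive]

lemma tanh_sub_isBigO :
    (fun z ↦ tanh z - (z - z ^ 3 / 3 + 2 * z ^ 5 / 15 - 17 * z ^ 7 / 315 + 62 * z ^ 9 / 2835))
      =O[𝓝[>] 0] fun z ↦ z ^ 11 := by
  have h : (fun z ↦ -2 / π ^ 12 * tanhTail 5 z) =O[𝓝[>] 0] fun _ ↦ (1 : ℝ) :=
    (((continuous_tanhTail (k := 5) (by lia)).const_mul _).tendsto 0).isBigO_one ℝ
      |>.mono nhdsWithin_le_nhds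
  refine ((isBigO_refl (fun z : ℝ ↦ z ^ 11) _).mul h).congr' ?_ (by simp)
  filter_upwards [self_mem_nhdsWithin] with z hz
  rw [tanh_eq_tanhTail_five hz]
  ring

lemma tanh_mul_sub_isBigO {f p q r : ℝ → ℝ}
    (hf : (fun z ↦ f z - p z) =O[𝓝[>] 0] fun z ↦ z ^ 11) (hp : Continuous p) (hr : Continuous r)
    (hq : ∀ z, (z - z ^ 3 / 3 + 2 * z ^ 5 / 15 - 17 * z ^ 7 / 315 + 62 * z ^ 9 / 2835) * p z =
      q z + z ^ 11 * r z) :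
    (fun z ↦ tanh z * f z - q z) =O[𝓝[>] 0] fun z ↦ z ^ 11 := by
  have hO {g : ℝ → ℝ} (hg : Continuous g) : g =O[𝓝[>] 0] fun _ ↦ (1 : ℝ) :=
    ((hg.tendsto 0).isBigO_one ℝ).mono nhdsWithin_le_nhds
  have h1 := (hO continuous_real_tanh).mul hf
  have h2 := (hO hp).mul tanh_sub_isBigO
  have h3 := (hO hr).mul (isBigO_refl (fun z : ℝ ↦ z ^ 11) _)
  refine ((h1.add h2).add h3).congr (fun z ↦ ?_) fun z ↦ one_mul _
  linear_combination -hq z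

lemma tanh_sq_sub_isBigO :
    (fun z ↦ tanh z ^ 2 -
      (z ^ 2 - 2 * z ^ 4 / 3 + 17 * z ^ 6 / 45 - 62 * z ^ 8 / 315 + 1382 * z ^ 10 / 14175))
      =O[𝓝[>] 0] fun z ↦ z ^ 11 := by
  simp only [pow_succ' (tanh _) 1, pow_one]
  exact tanh_mul_sub_isBigO (r := fun z ↦ -176 * z / 6075 + 2603 * z ^ 3 / 297675 -
    2108 * z ^ 5 / 893025 + 3844 * z ^ 7 / 8037225) tanh_sub_isBigO (by fun_prop) (by fun_prop)
    fun z ↦ by ring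

lemma tanh_pow_three_sub_isBigO :
    (fun z ↦ tanh z ^ 3 - (z ^ 3 - z ^ 5 + 11 * z ^ 7 / 15 - 88 * z ^ 9 / 189))
      =O[𝓝[>] 0] fun z ↦ z ^ 11 := by
  simp only [pow_succ' (tanh _) 2]
  exact tanh_mul_sub_isBigO (r := fun z ↦ 1282 / 4725 - 797 * z ^ 2 / 8505 +
    142364 * z ^ 4 / 4465125 - 226 * z ^ 6 / 23625 + 85684 * z ^ 8 / 40186125)
    tanh_sq_sub_isBigO (by fun_prop) (by fun_prop) fun z ↦ by ring

lemma tanh_pow_four_sub_isBigO :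
    (fun z ↦ tanh z ^ 4 - (z ^ 4 - 4 * z ^ 6 / 3 + 6 * z ^ 8 / 5 - 848 * z ^ 10 / 945))
      =O[𝓝[>] 0] fun z ↦ z ^ 11 := by
  simp only [pow_succ' (tanh _) 3]
  exact tanh_mul_sub_isBigO (r := fun z ↦ 4661 * z / 14175 - 1751 * z ^ 3 / 14175 +
    12254 * z ^ 5 / 297675 - 5456 * z ^ 7 / 535815)
    tanh_pow_three_sub_isBigO (by fun_prop) (by fun_prop) fun z ↦ by ring

lemma tanh_pow_five_sub_isBigO :
    (fun z ↦ tanh z ^ 5 - (z ^ 5 - 5 * z ^ 7 / 3 + 16 * z ^ 9 / 9))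
      =O[𝓝[>] 0] fun z ↦ z ^ 11 := by
  simp only [pow_succ' (tanh _) 4]
  exact tanh_mul_sub_isBigO (r := fun z ↦ -289 / 189 + 7838 * z ^ 2 / 14175 -
    9082 * z ^ 4 / 42525 + 22228 * z ^ 6 / 297675 - 52576 * z ^ 8 / 2679075)
    tanh_pow_four_sub_isBigO (by fun_prop) (by fun_prop) fun z ↦ by ring

lemma tendsto_div_pow_of_isBigO {f : ℝ → ℝ} {a b : ℕ} (hf : f =O[𝓝[>] 0] fun z ↦ z ^ a)
    (hab : b < a) : Tendsto (fun z ↦ f z / z ^ b) (𝓝[>] 0) (𝓝 0) := by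
  refine (hf.trans_isLittleO ?_).tendsto_div_nhds_zero
  exact (isLittleO_pow_pow hab).mono nhdsWithin_le_nhds

lemma tendsto_tanhPrimitive_zero : Tendsto tanhPrimitive (𝓝[>] 0) (𝓝 0) := by
  have h1 {b : ℕ} (hb : b < 11) := tendsto_div_pow_of_isBigO tanh_sub_isBigO hb
  have h2 {b : ℕ} (hb : b < 11) := tendsto_div_pow_of_isBigO tanh_sq_sub_isBigO hb
  have h3 {b : ℕ} (hb : b < 11) := tendsto_div_pow_of_isBigO tanh_pow_three_sub_isBigO hb
  have h4 {b : ℕ} (hb : b < 11) := tendsto_div_pow_of_isBigO tanh_pow_four_sub_isBigO hb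
  have h5 {b : ℕ} (hb : b < 11) := tendsto_div_pow_of_isBigO tanh_pow_five_sub_isBigO hb
  have hr : Tendsto (fun z : ℝ ↦ 35153 * z / 70875 - 23774 * z ^ 3 / 70875) (𝓝[>] 0) (𝓝 0) :=
    (Continuous.tendsto' (by fun_prop) 0 0 (by simp)).mono_left nhdsWithin_le_nhds
  have h := ((((((((((h5 (b := 6) (by lia)).const_mul (-(1 / 5))).add
    ((h4 (b := 7) (by lia)).const_mul (3 / 10))).sub
    ((h3 (b := 6) (by lia)).div_const 3)).sub ((h3 (b := 8) (by lia)).const_mul (7 / 10))).add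
    ((h2 (b := 7) (by lia)).const_mul (8 / 5))).add
    ((h2 (b := 9) (by lia)).const_mul (14 / 5))).sub (h1 (b := 6) (by lia))).sub
    ((h1 (b := 8) (by lia)).const_mul (133 / 10))).sub
    ((h1 (b := 10) (by lia)).const_mul (126 / 5))).add hr
  refine (h.congr' ?_).trans (by simp)
  filter_upwards [self_mem_nhdsWithin] with z hz
  have hz : z ≠ 0 := (ne_of_gt hz)
  rw [tanhPrimitive]
  generalize tanh z = t
  field_simp
  ring

lemma integral_tanh_pow_six_div :
    ∫ z in Ioi (0 : ℝ), tanh z ^ 6 / z ^ 6 =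
      92 / 5 / π ^ 8 * (∫ z in Ioi (0 : ℝ), tanhTail 3 z) -
      224 / π ^ 10 * (∫ z in Ioi (0 : ℝ), tanhTail 4 z) +
      504 / π ^ 12 * ∫ z in Ioi (0 : ℝ), tanhTail 5 z := by
  have i0 := integrableOn_tanh_pow_six_div
  have i3 := (integrableOn_tanhTail (k := 3) (by lia)).const_mul (92 / 5 / π ^ 8)
  have i4 := (integrableOn_tanhTail (k := 4) (by lia)).const_mul (224 / π ^ 10)
  have i5 := (integrableOn_tanhTail (k := 5) (by lia)).const_mul (504 / π ^ 12)
  have h00 : tanhPrimitive 0 = 0 := by simp [tanhPrimitive]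
  have hc : ContinuousWithinAt tanhPrimitive (Ici 0) 0 := by
    rw [← continuousWithinAt_Ioi_iff_Ici, ContinuousWithinAt, h00]
    exact tendsto_tanhPrimitive_zero
  have h := integral_Ioi_of_hasDerivAt_of_tendsto hc
    (fun z hz ↦ hasDerivAt_tanhPrimitive hz) (((i0.sub i3).add i4).sub i5)
    tendsto_tanhPrimitive_atTop
  rw [h00, integral_sub (by exact (i0.sub i3).add i4) i5, integral_add (by exact i0.sub i3) i4,
    integral_sub i0 i3, integral_const_mul, integral_const_mul, integral_const_mul] at h
  linear_combination h

lemma ofReal_tsum_one_div_nat_pow {k : ℕ} (hk : 1 < k) :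
    ((∑' n : ℕ, 1 / (n : ℝ) ^ k : ℝ) : ℂ) = riemannZeta k := by
  rw [zeta_nat_eq_tsum_of_gt_one hk]
  push_cast
  rfl

theorem stmt_8 :
    (↑(∫ z in Set.Ioi (0:ℝ), Real.tanh z ^ 6 / z ^ 6) : ℂ) = 5842 * riemannZeta 7 / (5 * (π:ℂ) ^ 6) - 57232 * riemannZeta 9 / (π:ℂ) ^ 8 + 515844 * riemannZeta 11 / (π:ℂ) ^ 10 := by
  have h7 := ofReal_tsum_one_div_nat_pow (k := 7) (by lia)
  have h9 := ofReal_tsum_one_div_nat_pow (k := 9) (by lia)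
  have h11 := ofReal_tsum_one_div_nat_pow (k := 11) (by lia)
  simp only [Nat.cast_ofNat] at h7 h9 h11
  have hpi : (π : ℂ) ≠ 0 := Complex.ofReal_ne_zero.2 pi_ne_zero
  rw [integral_tanh_pow_six_div, integral_tanhTail (by lia), integral_tanhTail (by lia),
    integral_tanhTail (by lia), ← h7, ← h9, ← h11]
  simp only [Complex.ofReal_add, Complex.ofReal_sub, Complex.ofReal_mul, Complex.ofReal_div,
    Complex.ofReal_pow, Complex.ofReal_ofNat, Complex.ofReal_one, Nat.reduceMul, Nat.reduceAdd]
  field_simp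
  ring
end

section
/- ∫₀^∞ tanh(z)⁷/z⁷ dz = -127 ζ(7)/π⁶ + 1402184 ζ(9)/(45π⁸) - 1003030 ζ(11)/π¹⁰ + 7568484 ζ(13)/π¹². -/
open Real MeasureTheory

open scoped Polynomial in
/-- The polynomials `p k` with `(d/dx)^k (π cot (π x)) = π ^ (k + 1) * p k (cot (π x))`. -/
noncomputable def cotDerivPoly : ℕ → ℂ[X]
  | 0 => Polynomial.X
  | k + 1 => -(1 + Polynomial.X ^ 2) * Polynomial.derivative (cotDerivPoly k)

section

open Complex
open UpperHalfPlane (upperHalfPlaneSet isOpen_upperHalfPlaneSet)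

lemma hasDerivAt_cot_pi_mul {z : ℂ} (hz : z ∈ integerComplement) :
    HasDerivAt (fun x : ℂ ↦ cot (π * x)) (-(1 + cot (π * z) ^ 2) * π) z := by
  have hs : sin (π * z) ≠ 0 := sin_pi_mul_ne_zero hz
  have hl : HasDerivAt (fun x : ℂ ↦ (π : ℂ) * x) (π : ℂ) z := by
    simpa using (hasDerivAt_id z).const_mul (π : ℂ)
  have h := hl.ccos.div hl.csin hs
  simp only [Complex.cot]
  refine h.congr_deriv ?_
  field_simp
  ring

lemma iteratedDerivWithin_cot_pi_mul_eq_eval (k : ℕ) :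
    Set.EqOn (iteratedDerivWithin k (fun x : ℂ ↦ π * cot (π * x)) upperHalfPlaneSet)
      (fun z ↦ (π : ℂ) ^ (k + 1) * (cotDerivPoly k).eval (cot (π * z))) upperHalfPlaneSet := by
  induction k with
  | zero => intro z _; simp [cotDerivPoly]
  | succ k ih =>
    intro z hz
    have hz' : z ∈ integerComplement := UpperHalfPlane.coe_mem_integerComplement ⟨z, hz⟩
    rw [iteratedDerivWithin_succ, derivWithin_congr ih (ih hz),
      derivWithin_of_isOpen isOpen_upperHalfPlaneSet hz]
    have h := (((cotDerivPoly k).hasDerivAt (cot (π * z))).comp z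
      (hasDerivAt_cot_pi_mul hz')).const_mul ((π : ℂ) ^ (k + 1))
    refine h.deriv.trans ?_
    simp only [cotDerivPoly, Polynomial.eval_mul, Polynomial.eval_neg, Polynomial.eval_add,
      Polynomial.eval_one, Polynomial.eval_pow, Polynomial.eval_X]
    ring

/-- The poles of `tanh` in the upper half-plane are `i * tanhPole n`. -/
noncomputable def tanhPole (n : ℕ) : ℝ := (n + 1 / 2) * π

lemma tanhPole_pos (n : ℕ) : 0 < tanhPole n := by unfold tanhPole; positivity

lemma mem_upperHalfPlaneSet_of_pos {z : ℝ} (hz : 0 < z) :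
    (I * z / π + 1 / 2 : ℂ) ∈ upperHalfPlaneSet := by
  have : (I * z / π + 1 / 2 : ℂ) = ((1 / 2 : ℝ) : ℂ) + ((z / π : ℝ) : ℂ) * I := by
    push_cast; ring
  rw [this]
  simp only [upperHalfPlaneSet, Set.mem_ofPred_eq, add_im, ofReal_im, mul_im, ofReal_re, I_im, I_re]
  have : 0 < z / π := by positivity
  simpa using this

lemma cot_pi_mul_eq_tanh (z : ℝ) :
    cot (π * (I * z / π + 1 / 2)) = -I * (Real.tanh z : ℂ) := by
  have hp : (π : ℂ) ≠ 0 := by exact_mod_cast Real.pi_ne_zero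
  have h : (π : ℂ) * (I * z / π + 1 / 2) = z * I + π / 2 := by field_simp
  rw [h, Complex.cot, Complex.cos_add_pi_div_two, Complex.sin_add_pi_div_two, neg_div,
    ← Complex.tan_eq_sin_div_cos, Complex.tan_mul_I]
  push_cast
  ring

lemma inv_pow_pole_pair {z a : ℝ} (hz : 0 < z) (k : ℕ) :
    1 / (I * z + a) ^ k + 1 / (I * z - a) ^ k =
      (-I) ^ k * ((z + I * a) ^ k + (z - I * a) ^ k) / ((z : ℂ) ^ 2 + a ^ 2) ^ k := by
  have h0 : ((z : ℂ) ^ 2 + a ^ 2) ≠ 0 := by exact_mod_cast (by positivity : z ^ 2 + a ^ 2 ≠ 0)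
  have h1 : (I * z + a) * (-I * (z + I * a)) = ((z : ℂ) ^ 2 + a ^ 2) := by
    linear_combination (-(z : ℂ) ^ 2 - a ^ 2 - I * z * a) * I_sq
  have h2 : (I * z - a) * (-I * (z - I * a)) = ((z : ℂ) ^ 2 + a ^ 2) := by
    linear_combination (-(z : ℂ) ^ 2 - a ^ 2 + I * z * a) * I_sq
  have e1 : 1 / (I * z + a) = (-I * (z + I * a)) / ((z : ℂ) ^ 2 + a ^ 2) := by
    rw [div_eq_div_iff (left_ne_zero_of_mul (h1 ▸ h0)) h0, one_mul, ← h1]; ring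
  have e2 : 1 / (I * z - a) = (-I * (z - I * a)) / ((z : ℂ) ^ 2 + a ^ 2) := by
    rw [div_eq_div_iff (left_ne_zero_of_mul (h2 ▸ h0)) h0, one_mul, ← h2]; ring
  rw [← one_div_pow, ← one_div_pow, e1, e2, div_pow, div_pow, mul_pow, mul_pow]
  ring

lemma hasSum_pole_pair_iteratedDeriv {z : ℝ} (hz : 0 < z) {k : ℕ} (hk : 1 ≤ k) :
    HasSum (fun n : ℕ ↦ 1 / (I * z + tanhPole n) ^ (k + 1) + 1 / (I * z - tanhPole n) ^ (k + 1))
      ((-1) ^ k / (k.factorial : ℂ) * (cotDerivPoly k).eval (-I * (Real.tanh z : ℂ))) := by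
  have hp : (π : ℂ) ≠ 0 := by exact_mod_cast Real.pi_ne_zero
  have hf : (k.factorial : ℂ) ≠ 0 := by exact_mod_cast k.factorial_ne_zero
  have hm := mem_upperHalfPlaneSet_of_pos hz
  set w : ℂ := I * z / π + 1 / 2 with hw
  have h1 := iteratedDerivWithin_cot_pi_mul_eq_eval k hm
  rw [iteratedDerivWithin_cot_pi_mul_eq_mul_tsum_div_pow hk hm] at h1
  simp only [cot_pi_mul_eq_tanh, hw] at h1
  rw [← hw] at h1
  have hs : Summable fun n : ℤ ↦ 1 / (w + n) ^ (k + 1) := by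
    have := EisensteinSeries.linear_right_summable w 1 (k := (k + 1 : ℕ)) (by lia)
    refine this.congr fun n ↦ ?_
    rw [zpow_natCast]
    simp
  have h2 := (hs.hasSum.nat_add_neg_add_one).mul_left (1 / (π : ℂ) ^ (k + 1))
  have h3 : ((-1 : ℂ) ^ k) * (-1) ^ k = 1 := by rw [← mul_pow]; simp
  set S := ∑' n : ℤ, 1 / (w + n) ^ (k + 1)
  generalize Polynomial.eval (-I * (Real.tanh z : ℂ)) (cotDerivPoly k) = E at h1 ⊢
  have hS : (-1) ^ k / (k.factorial : ℂ) * E = 1 / (π : ℂ) ^ (k + 1) * S := by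
    field_simp
    linear_combination (-1) ^ k * (-h1) + k.factorial * S * h3
  rw [hS]
  refine h2.congr_fun fun n ↦ ?_
  have e1 : (π : ℂ) * (w + ((n : ℤ) : ℂ)) = I * z + tanhPole n := by
    rw [hw, tanhPole]; push_cast; field_simp; ring
  have e2 : (π : ℂ) * (w + ((-((n : ℤ) + 1) : ℤ) : ℂ)) = I * z - tanhPole n := by
    rw [hw, tanhPole]; push_cast; field_simp; ring
  rw [← e1, ← e2, mul_add (1 / (π : ℂ) ^ (k + 1)), one_div_mul_one_div, one_div_mul_one_div,
    ← mul_pow, ← mul_pow]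

lemma hasSum_pole_pair_tanh {z : ℝ} (hz : 0 < z) :
    HasSum (fun n : ℕ ↦ 2 * z / (z ^ 2 + tanhPole n ^ 2)) (Real.tanh z) := by
  have hp : (π : ℂ) ≠ 0 := by exact_mod_cast Real.pi_ne_zero
  have hm := mem_upperHalfPlaneSet_of_pos hz
  have hc := cot_pi_mul_eq_tanh z
  set w : ℂ := I * z / π + 1 / 2 with hw
  have hw' : w ∈ integerComplement := UpperHalfPlane.coe_mem_integerComplement ⟨w, hm⟩
  have hs : Summable fun n : ℕ ↦ 2 * z / (z ^ 2 + tanhPole n ^ 2) := by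
    have h1 : Summable fun n : ℕ ↦ 2 * z * (1 / ((n : ℝ) + 1 / 2) ^ 2) :=
      ((Real.summable_one_div_nat_add_rpow (1 / 2) 2).mpr one_lt_two).mul_left (2 * z) |>.congr
        fun n ↦ by rw [abs_of_pos (by positivity)]; norm_cast
    refine h1.of_nonneg_of_le (fun n ↦ by positivity) fun n ↦ ?_
    rw [mul_one_div]
    have : ((n : ℝ) + 1 / 2) ≤ tanhPole n := by
      unfold tanhPole
      exact le_mul_of_one_le_right (by positivity) (by linarith [Real.pi_gt_three])
    gcongr
    nlinarith
  rw [hs.hasSum_iff_tendsto_nat, ← Filter.tendsto_ofReal_iff]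
  have h1 := (summable_cotTerm hw').hasSum.tendsto_sum_nat
  have h2 : ∑' n : ℕ, cotTerm w n = π * cot (π * w) - 1 / w := (cot_series_rep' hw').symm
  have h3 : Filter.Tendsto (fun n : ℕ ↦ 1 / (w + n)) Filter.atTop (nhds 0) := by
    simpa using EisensteinSeries.tendsto_zero_inv_linear w 1
  have h4 := ((h1.sub h3).add_const (1 / w)).const_mul (I / π)
  have h5 : I / π * (∑' n : ℕ, cotTerm w n - 0 + 1 / w) = Real.tanh z := by
    rw [h2, hc]
    field_simp
    linear_combination (-(π : ℂ) * (Real.tanh z : ℂ)) * I_sq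
  rw [h5] at h4
  refine h4.congr fun N ↦ ?_
  have hne (n : ℤ) : w + n ≠ 0 := integerComplement_add_ne_zero hw' n
  have h6 : ∑ n ∈ Finset.range N, cotTerm w n - 1 / (w + N) + 1 / w =
      ∑ n ∈ Finset.range N, (1 / (w - (n + 1)) + 1 / (w + n)) := by
    induction N with
    | zero => simp
    | succ N ih =>
      rw [Finset.sum_range_succ, Finset.sum_range_succ, ← ih, cotTerm]
      push_cast
      ring
  rw [h6, Finset.mul_sum]
  push_cast
  refine Finset.sum_congr rfl fun n _ ↦ ?_
  have e1 : I * z + tanhPole n = (π : ℂ) * (w + n) := by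
    rw [hw, tanhPole]; push_cast; field_simp; ring
  have e2 : I * z - tanhPole n = (π : ℂ) * (w - (n + 1)) := by
    rw [hw, tanhPole]; push_cast; field_simp; ring
  have h7 := inv_pow_pole_pair (a := tanhPole n) hz 1
  simp only [pow_one, e1, e2] at h7
  have h0 : ((z : ℂ) ^ 2 + tanhPole n ^ 2) ≠ 0 := by
    exact_mod_cast (by positivity : z ^ 2 + tanhPole n ^ 2 ≠ 0)
  have h8 : I / π * (1 / (w - (n + 1)) + 1 / (w + n)) =
      I * (1 / (π * (w + n)) + 1 / (π * (w - (n + 1)))) := by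
    rw [← one_div_mul_one_div, ← one_div_mul_one_div]
    ring
  rw [h8, h7]
  field_simp
  linear_combination (-2 * (z : ℂ)) * I_sq

lemma hasSum_pole_pair_tanh_deriv {z : ℝ} (hz : 0 < z) {k : ℕ} (hk : 1 ≤ k) {N : ℕ → ℝ} {E : ℝ}
    (hN : ∀ n, ((z : ℂ) + I * tanhPole n) ^ (k + 1) + (z - I * tanhPole n) ^ (k + 1) = N n)
    (hE : I ^ (k + 1) * ((-1) ^ k / (k.factorial : ℂ) *
      (cotDerivPoly k).eval (-I * (Real.tanh z : ℂ))) = E) :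
    HasSum (fun n ↦ N n / (z ^ 2 + tanhPole n ^ 2) ^ (k + 1)) E := by
  rw [← hasSum_ofReal, ← hE]
  refine ((hasSum_pole_pair_iteratedDeriv hz hk).mul_left (I ^ (k + 1))).congr_fun fun n ↦ ?_
  rw [inv_pow_pole_pair hz, hN, mul_div_assoc, ← mul_assoc, ← mul_pow]
  simp

lemma hasSum_pole_pair_tanh_deriv_two {z : ℝ} (hz : 0 < z) :
    HasSum (fun n ↦ (2 * z ^ 3 - 6 * z * tanhPole n ^ 2) / (z ^ 2 + tanhPole n ^ 2) ^ 3)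
      (Real.tanh z ^ 3 - Real.tanh z) := by
  refine hasSum_pole_pair_tanh_deriv hz one_le_two (fun n ↦ ?_) ?_
  · push_cast
    linear_combination 6 * (z : ℂ) * tanhPole n ^ 2 * I_sq
  · simp [cotDerivPoly, Nat.factorial]
    generalize Complex.tanh z = t
    ring_nf
    norm_num [I_pow_eq_pow_mod]
    rw [I_sq]
    ring

lemma hasSum_pole_pair_tanh_deriv_four {z : ℝ} (hz : 0 < z) :
    HasSum (fun n ↦ (2 * z ^ 5 - 20 * z ^ 3 * tanhPole n ^ 2 + 10 * z * tanhPole n ^ 4) /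
        (z ^ 2 + tanhPole n ^ 2) ^ 5)
      (Real.tanh z ^ 5 - 5 / 3 * Real.tanh z ^ 3 + 2 / 3 * Real.tanh z) := by
  refine hasSum_pole_pair_tanh_deriv hz (by norm_num) (fun n ↦ ?_) ?_
  · push_cast
    linear_combination (20 * (z : ℂ) ^ 3 * tanhPole n ^ 2 +
      10 * z * tanhPole n ^ 4 * (I ^ 2 - 1)) * I_sq
  · simp [cotDerivPoly, Nat.factorial]
    generalize Complex.tanh z = t
    ring_nf
    norm_num [I_pow_eq_pow_mod]
    rw [I_sq]
    ring

lemma hasSum_pole_pair_tanh_deriv_six {z : ℝ} (hz : 0 < z) :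
    HasSum (fun n ↦ (2 * z ^ 7 - 42 * z ^ 5 * tanhPole n ^ 2 + 70 * z ^ 3 * tanhPole n ^ 4
        - 14 * z * tanhPole n ^ 6) / (z ^ 2 + tanhPole n ^ 2) ^ 7)
      (Real.tanh z ^ 7 - 7 / 3 * Real.tanh z ^ 5 + 77 / 45 * Real.tanh z ^ 3
        - 17 / 45 * Real.tanh z) := by
  refine hasSum_pole_pair_tanh_deriv hz (by norm_num) (fun n ↦ ?_) ?_
  · push_cast
    linear_combination (42 * (z : ℂ) ^ 5 * tanhPole n ^ 2 +
      70 * z ^ 3 * tanhPole n ^ 4 * (I ^ 2 - 1) +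
      14 * z * tanhPole n ^ 6 * (I ^ 4 - I ^ 2 + 1)) * I_sq
  · simp [cotDerivPoly, Nat.factorial]
    generalize Complex.tanh z = t
    ring_nf
    norm_num [I_pow_eq_pow_mod]
    rw [I_sq]
    ring

end

lemma summable_and_tsum_tanhPole_inv_pow {k : ℕ} (hk : 1 < k) :
    Summable (fun n ↦ (tanhPole n ^ k)⁻¹) ∧
      ((∑' n, (tanhPole n ^ k)⁻¹ : ℝ) : ℂ) = (2 ^ k - 1) * riemannZeta k / (π : ℂ) ^ k := by
  have hs : Summable fun n : ℕ ↦ ((n : ℝ) ^ k)⁻¹ := Real.summable_nat_pow_inv.mpr hk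
  have he : Summable fun n : ℕ ↦ (((2 * n : ℕ) : ℝ) ^ k)⁻¹ :=
    hs.comp_injective (i := fun n ↦ 2 * n) fun a b h ↦ by simpa using h
  have ho : Summable fun n : ℕ ↦ (((2 * n + 1 : ℕ) : ℝ) ^ k)⁻¹ :=
    hs.comp_injective (i := fun n ↦ 2 * n + 1) fun a b h ↦ by simpa using h
  have h1 := tsum_even_add_odd (f := fun n : ℕ ↦ ((n : ℝ) ^ k)⁻¹) he ho
  have h2 (n : ℕ) : (((2 * n : ℕ) : ℝ) ^ k)⁻¹ = (2 ^ k)⁻¹ * ((n : ℝ) ^ k)⁻¹ := by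
    push_cast; rw [mul_pow, mul_inv]
  have h3 (n : ℕ) : (tanhPole n ^ k)⁻¹ = 2 ^ k / π ^ k * (((2 * n + 1 : ℕ) : ℝ) ^ k)⁻¹ := by
    have : tanhPole n = (2 * n + 1 : ℕ) * π / 2 := by unfold tanhPole; push_cast; ring
    rw [this, div_pow, mul_pow]
    field_simp
  simp_rw [h2, tsum_mul_left] at h1
  have hz : riemannZeta k = ((∑' n : ℕ, ((n : ℝ) ^ k)⁻¹ : ℝ) : ℂ) := by
    rw [zeta_nat_eq_tsum_of_gt_one hk]; push_cast; simp
  simp_rw [h3, tsum_mul_left]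
  refine ⟨ho.mul_left _, ?_⟩
  rw [hz, eq_sub_of_add_eq' h1]
  have hp : (π : ℂ) ≠ 0 := by exact_mod_cast Real.pi_ne_zero
  push_cast
  field_simp

lemma summable_tanhPole_inv_pow {k : ℕ} (hk : 1 < k) : Summable (fun n ↦ (tanhPole n ^ k)⁻¹) :=
  (summable_and_tsum_tanhPole_inv_pow hk).1

lemma integrable_inv_one_add_sq_pow (m : ℕ) :
    Integrable fun u : ℝ ↦ ((1 + u ^ 2) ^ (m + 1))⁻¹ := by
  refine integrable_inv_one_add_sq.mono' ?_ (.of_forall fun u ↦ ?_)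
  · refine Continuous.aestronglyMeasurable (Continuous.inv₀ (by fun_prop) fun u ↦ by positivity)
  · rw [Real.norm_of_nonneg (by positivity)]
    gcongr
    exact le_self_pow₀ (by nlinarith) (by lia)

lemma integral_Ioi_inv_one_add_sq_pow (m : ℕ) :
    ∫ u in Set.Ioi (0 : ℝ), ((1 + u ^ 2) ^ (m + 1))⁻¹ =
      π / 2 * ∏ i ∈ Finset.range m, ((2 * i + 1) / (2 * i + 2) : ℝ) := by
  induction m with
  | zero => simp
  | succ m ih =>
    have hd (u : ℝ) : HasDerivAt (fun u : ℝ ↦ u * ((1 + u ^ 2) ^ (m + 1))⁻¹)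
        (-(2 * m + 1) * ((1 + u ^ 2) ^ (m + 1))⁻¹ +
          (2 * m + 2) * ((1 + u ^ 2) ^ (m + 1 + 1))⁻¹) u := by
      have h0 : (1 + u ^ 2) ≠ 0 := by positivity
      have h1 : HasDerivAt (fun u : ℝ ↦ 1 + u ^ 2) (2 * u) u := by
        simpa using (hasDerivAt_pow 2 u).const_add 1
      refine ((hasDerivAt_id u).mul ((h1.pow (m + 1)).inv (pow_ne_zero _ h0))).congr_deriv ?_
      simp only [id, Nat.add_sub_cancel, pow_succ, Pi.pow_apply, Pi.inv_apply, Pi.mul_apply]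
      push_cast
      field_simp
      ring
    have hl : Filter.Tendsto (fun u : ℝ ↦ u * ((1 + u ^ 2) ^ (m + 1))⁻¹) Filter.atTop (nhds 0) := by
      refine squeeze_zero' (g := fun u ↦ u⁻¹) ?_ ?_ tendsto_inv_atTop_zero
      · filter_upwards [Filter.eventually_gt_atTop 0] with u hu
        positivity
      · filter_upwards [Filter.eventually_gt_atTop 0] with u hu
        have : u ^ 2 ≤ (1 + u ^ 2) ^ (m + 1) :=
          (by linarith : u ^ 2 ≤ 1 + u ^ 2).trans (le_self_pow₀ (by nlinarith) (by lia))
        rw [← div_eq_mul_inv, div_le_iff₀ (by positivity), inv_mul_eq_div, le_div_iff₀ hu]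
        nlinarith
    have hi (k : ℕ) := (integrable_inv_one_add_sq_pow k).integrableOn (s := Set.Ioi 0)
    have h := integral_Ioi_of_hasDerivAt_of_tendsto' (a := 0) (fun u _ ↦ hd u)
      (((hi m).const_mul _).add ((hi (m + 1)).const_mul _)) hl
    rw [integral_add ((hi m).const_mul _) ((hi (m + 1)).const_mul _), integral_const_mul,
      integral_const_mul, ih] at h
    rw [Finset.prod_range_succ]
    generalize ∏ i ∈ Finset.range m, ((2 * i + 1) / (2 * i + 2) : ℝ) = P at h ⊢
    generalize ∫ u in Set.Ioi (0 : ℝ), ((1 + u ^ 2) ^ (m + 1 + 1))⁻¹ = J at h ⊢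
    have h0 : (2 * m + 2 : ℝ) ≠ 0 := by positivity
    field_simp
    linear_combination 2 * h

/-- Linear combination of the functions `(1 + u ^ 2)⁻¹ ^ (m + 1)` for `m < 7`. -/
noncomputable def invOneAddSqComb (e : Fin 7 → ℝ) (u : ℝ) : ℝ :=
  ∑ m : Fin 7, e m * ((1 + u ^ 2) ^ (m.val + 1))⁻¹

lemma integrable_invOneAddSqComb (e : Fin 7 → ℝ) : Integrable (invOneAddSqComb e) :=
  integrable_finsetSum _ fun m _ ↦ (integrable_inv_one_add_sq_pow m).const_mul _

lemma integral_invOneAddSqComb (e : Fin 7 → ℝ) :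
    ∫ u in Set.Ioi 0, invOneAddSqComb e u =
      ∑ m : Fin 7, e m * (π / 2 * ∏ i ∈ Finset.range m, ((2 * i + 1) / (2 * i + 2) : ℝ)) := by
  unfold invOneAddSqComb
  rw [integral_finsetSum (f := fun (m : Fin 7) (u : ℝ) ↦ e m * ((1 + u ^ 2) ^ (m.val + 1))⁻¹) _
    fun m _ ↦ ((integrable_inv_one_add_sq_pow m).const_mul _).integrableOn]
  simp_rw [integral_const_mul, integral_Ioi_inv_one_add_sq_pow]

lemma abs_invOneAddSqComb_le (e : Fin 7 → ℝ) (u : ℝ) :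
    |invOneAddSqComb e u| ≤ ∑ m : Fin 7, |e m| := by
  refine (Finset.abs_sum_le_sum_abs _ _).trans (Finset.sum_le_sum fun m _ ↦ ?_)
  rw [abs_mul, abs_of_nonneg (a := ((1 + u ^ 2) ^ (m.val + 1))⁻¹) (by positivity)]
  exact mul_le_of_le_one_right (abs_nonneg _)
    (inv_le_one_of_one_le₀ (one_le_pow₀ (by nlinarith)))

lemma integrableOn_Ioi_comp_div {f : ℝ → ℝ} (hf : IntegrableOn f (Set.Ioi 0)) {a : ℝ}
    (ha : 0 < a) : IntegrableOn (fun z ↦ f (z / a)) (Set.Ioi 0) := by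
  simp_rw [div_eq_mul_inv]
  simpa using (integrableOn_Ioi_comp_mul_right_iff f 0 (inv_pos.mpr ha)).mpr (by simpa using hf)

lemma integral_Ioi_comp_div (f : ℝ → ℝ) {a : ℝ} (ha : 0 < a) :
    ∫ z in Set.Ioi 0, f (z / a) = a * ∫ u in Set.Ioi 0, f u := by
  simp_rw [div_eq_mul_inv]
  rw [integral_comp_mul_right_Ioi f 0 (inv_pos.mpr ha)]
  simp

/-- Coefficients of the Taylor remainders of the pole parts of `tanh ^ 7`. -/
noncomputable def tanhSevenCoeff : Fin 4 → Fin 7 → ℝ :=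
  ![![-2, 0, 0, 0, 0, 0, 0],
    ![98 / 45 * 42, 98 / 45 * 22, 98 / 45 * 8, 0, 0, 0, 0],
    ![7 / 3 * -252, 7 / 3 * -182, 7 / 3 * -122, 7 / 3 * -72, 7 / 3 * -32, 0, 0],
    ![924, 756, 602, 462, 336, 224, 128]]

/-- The contribution of the poles `± i tanhPole n` to `(tanh z / z) ^ 7`, without its singular
part at `0`. -/
noncomputable def tanhSevenTerm (n : ℕ) (z : ℝ) : ℝ :=
  ∑ j : Fin 4, (tanhPole n ^ (2 * j.val + 8))⁻¹ *
    invOneAddSqComb (tanhSevenCoeff j) (z / tanhPole n)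

lemma pole_pair_decomposition {z a : ℝ} (hz : 0 < z) (ha : 0 < a) :
    (2 * z / (z ^ 2 + a ^ 2) +
      98 / 45 * ((2 * z ^ 3 - 6 * z * a ^ 2) / (z ^ 2 + a ^ 2) ^ 3) +
      7 / 3 * ((2 * z ^ 5 - 20 * z ^ 3 * a ^ 2 + 10 * z * a ^ 4) / (z ^ 2 + a ^ 2) ^ 5) +
      (2 * z ^ 7 - 42 * z ^ 5 * a ^ 2 + 70 * z ^ 3 * a ^ 4 - 14 * z * a ^ 6) /
        (z ^ 2 + a ^ 2) ^ 7) / z ^ 7 =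
    (2 * (a ^ 2)⁻¹ - 98 / 45 * 6 * (a ^ 4)⁻¹ + 7 / 3 * 10 * (a ^ 6)⁻¹ - 14 * (a ^ 8)⁻¹) / z ^ 6 +
    (-2 * (a ^ 4)⁻¹ + 98 / 45 * 20 * (a ^ 6)⁻¹ - 7 / 3 * 70 * (a ^ 8)⁻¹ + 168 * (a ^ 10)⁻¹) / z ^ 4 +
    (2 * (a ^ 6)⁻¹ - 98 / 45 * 42 * (a ^ 8)⁻¹ + 7 / 3 * 252 * (a ^ 10)⁻¹ - 924 * (a ^ 12)⁻¹) / z ^ 2 +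
    ∑ j : Fin 4, (a ^ (2 * j.val + 8))⁻¹ * invOneAddSqComb (tanhSevenCoeff j) (z / a) := by
  have h0 : z ^ 2 + a ^ 2 ≠ 0 := by positivity
  have e0 : 2 * z / (z ^ 2 + a ^ 2) / z ^ 7 =
      2 * (a ^ 2)⁻¹ / z ^ 6 - 2 * (a ^ 4)⁻¹ / z ^ 4 + 2 * (a ^ 6)⁻¹ / z ^ 2 +
        (a ^ 8)⁻¹ * invOneAddSqComb (tanhSevenCoeff 0) (z / a) := by
    simp [invOneAddSqComb, Fin.sum_univ_succ, tanhSevenCoeff]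
    have h1 : 1 + (z / a) ^ 2 = (z ^ 2 + a ^ 2) / a ^ 2 := by field_simp; ring
    rw [h1]
    field_simp
    ring
  have e1 : 98 / 45 * ((2 * z ^ 3 - 6 * z * a ^ 2) / (z ^ 2 + a ^ 2) ^ 3) / z ^ 7 =
      - 98 / 45 * 6 * (a ^ 4)⁻¹ / z ^ 6 + 98 / 45 * 20 * (a ^ 6)⁻¹ / z ^ 4
        - 98 / 45 * 42 * (a ^ 8)⁻¹ / z ^ 2 +
        (a ^ 10)⁻¹ * invOneAddSqComb (tanhSevenCoeff 1) (z / a) := by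
    simp [invOneAddSqComb, Fin.sum_univ_succ, tanhSevenCoeff]
    have h1 : 1 + (z / a) ^ 2 = (z ^ 2 + a ^ 2) / a ^ 2 := by field_simp; ring
    rw [h1]
    field_simp
    ring
  have e2 : 7 / 3 * ((2 * z ^ 5 - 20 * z ^ 3 * a ^ 2 + 10 * z * a ^ 4) / (z ^ 2 + a ^ 2) ^ 5)
        / z ^ 7 =
      7 / 3 * 10 * (a ^ 6)⁻¹ / z ^ 6 - 7 / 3 * 70 * (a ^ 8)⁻¹ / z ^ 4
        + 7 / 3 * 252 * (a ^ 10)⁻¹ / z ^ 2 +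
        (a ^ 12)⁻¹ * invOneAddSqComb (tanhSevenCoeff 2) (z / a) := by
    simp [invOneAddSqComb, Fin.sum_univ_succ, tanhSevenCoeff]
    have h1 : 1 + (z / a) ^ 2 = (z ^ 2 + a ^ 2) / a ^ 2 := by field_simp; ring
    rw [h1]
    field_simp
    ring
  have e3 : (2 * z ^ 7 - 42 * z ^ 5 * a ^ 2 + 70 * z ^ 3 * a ^ 4 - 14 * z * a ^ 6) /
        (z ^ 2 + a ^ 2) ^ 7 / z ^ 7 =
      - 14 * (a ^ 8)⁻¹ / z ^ 6 + 168 * (a ^ 10)⁻¹ / z ^ 4 - 924 * (a ^ 12)⁻¹ / z ^ 2 +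
        (a ^ 14)⁻¹ * invOneAddSqComb (tanhSevenCoeff 3) (z / a) := by
    simp [invOneAddSqComb, Fin.sum_univ_succ, tanhSevenCoeff]
    have h1 : 1 + (z / a) ^ 2 = (z ^ 2 + a ^ 2) / a ^ 2 := by field_simp; ring
    rw [h1]
    field_simp
    ring
  rw [add_div, add_div, add_div, e0, e1, e2, e3, Fin.sum_univ_four]
  norm_num only [Fin.val_zero, Fin.val_one, Fin.val_two, Fin.coe_ofNat_eq_mod]
  ring

lemma exists_hasSum_tanhSevenTerm : ∃ A B C : ℝ, ∀ z : ℝ, 0 < z →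
    HasSum (fun n ↦ tanhSevenTerm n z)
      ((Real.tanh z / z) ^ 7 - A / z ^ 6 - B / z ^ 4 - C / z ^ 2) := by
  have hs {k : ℕ} (hk : 1 < k) := summable_tanhPole_inv_pow hk
  have hA : Summable fun n ↦ 2 * (tanhPole n ^ 2)⁻¹ - 98 / 45 * 6 * (tanhPole n ^ 4)⁻¹
      + 7 / 3 * 10 * (tanhPole n ^ 6)⁻¹ - 14 * (tanhPole n ^ 8)⁻¹ :=
    ((((hs (by norm_num)).mul_left _).sub ((hs (by norm_num)).mul_left _)).add
      ((hs (by norm_num)).mul_left _)).sub ((hs (by norm_num)).mul_left _)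
  have hB : Summable fun n ↦ -2 * (tanhPole n ^ 4)⁻¹ + 98 / 45 * 20 * (tanhPole n ^ 6)⁻¹
      - 7 / 3 * 70 * (tanhPole n ^ 8)⁻¹ + 168 * (tanhPole n ^ 10)⁻¹ :=
    ((((hs (by norm_num)).mul_left _).add ((hs (by norm_num)).mul_left _)).sub
      ((hs (by norm_num)).mul_left _)).add ((hs (by norm_num)).mul_left _)
  have hC : Summable fun n ↦ 2 * (tanhPole n ^ 6)⁻¹ - 98 / 45 * 42 * (tanhPole n ^ 8)⁻¹
      + 7 / 3 * 252 * (tanhPole n ^ 10)⁻¹ - 924 * (tanhPole n ^ 12)⁻¹ :=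
    ((((hs (by norm_num)).mul_left _).sub ((hs (by norm_num)).mul_left _)).add
      ((hs (by norm_num)).mul_left _)).sub ((hs (by norm_num)).mul_left _)
  obtain ⟨A, hA⟩ := hA
  obtain ⟨B, hB⟩ := hB
  obtain ⟨C, hC⟩ := hC
  refine ⟨A, B, C, fun z hz ↦ ?_⟩
  have h := ((((hasSum_pole_pair_tanh hz).add
    ((hasSum_pole_pair_tanh_deriv_two hz).mul_left (98 / 45))).add
    ((hasSum_pole_pair_tanh_deriv_four hz).mul_left (7 / 3))).add
    (hasSum_pole_pair_tanh_deriv_six hz)).div_const (z ^ 7)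
  have h' := ((h.sub (hA.div_const (z ^ 6))).sub (hB.div_const (z ^ 4))).sub
    (hC.div_const (z ^ 2))
  have hv : (Real.tanh z / z) ^ 7 - A / z ^ 6 - B / z ^ 4 - C / z ^ 2 =
      (Real.tanh z + 98 / 45 * (Real.tanh z ^ 3 - Real.tanh z) +
        7 / 3 * (Real.tanh z ^ 5 - 5 / 3 * Real.tanh z ^ 3 + 2 / 3 * Real.tanh z) +
        (Real.tanh z ^ 7 - 7 / 3 * Real.tanh z ^ 5 + 77 / 45 * Real.tanh z ^ 3
          - 17 / 45 * Real.tanh z)) / z ^ 7 - A / z ^ 6 - B / z ^ 4 - C / z ^ 2 := by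
    rw [div_pow]
    ring
  rw [hv]
  refine h'.congr_fun fun n ↦ ?_
  rw [pole_pair_decomposition hz (tanhPole_pos n), tanhSevenTerm]
  ring

lemma exists_abs_tanhSevenTerm_le :
    ∃ M : ℕ → ℝ, Summable M ∧ ∀ n z, |tanhSevenTerm n z| ≤ M n := by
  refine ⟨fun n ↦ ∑ j : Fin 4, (tanhPole n ^ (2 * j.val + 8))⁻¹ * ∑ m, |tanhSevenCoeff j m|,
    summable_sum fun j _ ↦ (summable_tanhPole_inv_pow (by lia)).mul_right _, fun n z ↦ ?_⟩
  refine (Finset.abs_sum_le_sum_abs _ _).trans (Finset.sum_le_sum fun j _ ↦ ?_)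
  have := tanhPole_pos n
  rw [abs_mul, abs_of_nonneg (by positivity)]
  gcongr
  exact abs_invOneAddSqComb_le _ _

lemma exists_abs_tanh_div_pow_seven_le : ∃ K : ℝ, ∀ z : ℝ, 0 < z → |(Real.tanh z / z) ^ 7| ≤ K := by
  have hs := (summable_tanhPole_inv_pow one_lt_two).mul_left 2
  refine ⟨(∑' n, 2 * (tanhPole n ^ 2)⁻¹) ^ 7, fun z hz ↦ ?_⟩
  have h := (hasSum_pole_pair_tanh hz).div_const z
  have h0 : 0 ≤ Real.tanh z / z := h.nonneg fun n ↦ by positivity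
  have h1 : Real.tanh z / z ≤ ∑' n, 2 * (tanhPole n ^ 2)⁻¹ := by
    refine hasSum_le (fun n ↦ ?_) h hs.hasSum
    have := tanhPole_pos n
    rw [div_right_comm, mul_div_cancel_right₀ _ hz.ne', ← div_eq_mul_inv]
    gcongr
    nlinarith
  rw [abs_of_nonneg (by positivity)]
  gcongr

lemma eq_zero_of_abs_add_le_pow {a b c K : ℝ} (m : ℕ)
    (h : ∀ z : ℝ, 0 < z → |a + b * z ^ 2 + c * z ^ 4| ≤ K * z ^ (m + 1)) : a = 0 := by
  have h1 : Filter.Tendsto (fun z : ℝ ↦ |a + b * z ^ 2 + c * z ^ 4|) (nhdsWithin 0 (Set.Ioi 0))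
      (nhds |a|) := by
    have : Continuous fun z : ℝ ↦ |a + b * z ^ 2 + c * z ^ 4| := by fun_prop
    simpa using this.tendsto 0 |>.mono_left nhdsWithin_le_nhds
  have h2 : Filter.Tendsto (fun z : ℝ ↦ K * z ^ (m + 1)) (nhdsWithin 0 (Set.Ioi 0)) (nhds 0) := by
    have : Continuous fun z : ℝ ↦ K * z ^ (m + 1) := by fun_prop
    simpa using this.tendsto 0 |>.mono_left nhdsWithin_le_nhds
  have h3 := le_of_tendsto_of_tendsto h1 h2
    (by filter_upwards [self_mem_nhdsWithin] with z hz using h z hz)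
  exact abs_eq_zero.mp (le_antisymm h3 (abs_nonneg _))

lemma eq_zero_of_abs_inv_pow_le {A B C K : ℝ}
    (h : ∀ z : ℝ, 0 < z → |A / z ^ 6 + B / z ^ 4 + C / z ^ 2| ≤ K) :
    A = 0 ∧ B = 0 ∧ C = 0 := by
  have key (k : ℕ) {z : ℝ} (hz : 0 < z) :
      |(A / z ^ 6 + B / z ^ 4 + C / z ^ 2) * z ^ k| ≤ K * z ^ k := by
    rw [abs_mul, abs_of_pos (pow_pos hz k)]
    exact mul_le_mul_of_nonneg_right (h z hz) (by positivity)
  obtain rfl : A = 0 := eq_zero_of_abs_add_le_pow (b := B) (c := C) 5 fun z hz ↦ by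
    convert key 6 hz using 2
    field_simp
  obtain rfl : B = 0 := eq_zero_of_abs_add_le_pow (b := C) (c := 0) 3 fun z hz ↦ by
    convert key 4 hz using 2
    field_simp
    ring
  obtain rfl : C = 0 := eq_zero_of_abs_add_le_pow (b := 0) (c := 0) 1 fun z hz ↦ by
    convert key 2 hz using 2
    field_simp
    ring
  simp

lemma hasSum_tanhSevenTerm {z : ℝ} (hz : 0 < z) :
    HasSum (fun n ↦ tanhSevenTerm n z) ((Real.tanh z / z) ^ 7) := by
  obtain ⟨A, B, C, h⟩ := exists_hasSum_tanhSevenTerm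
  obtain ⟨M, hM, hMle⟩ := exists_abs_tanhSevenTerm_le
  obtain ⟨K, hK⟩ := exists_abs_tanh_div_pow_seven_le
  obtain ⟨rfl, rfl, rfl⟩ := eq_zero_of_abs_inv_pow_le (A := A) (B := B) (C := C)
    (K := K + ∑' n, M n) fun z hz ↦ by
      have h1 : |∑' n, tanhSevenTerm n z| ≤ ∑' n, M n :=
        tsum_of_norm_bounded (f := fun n ↦ tanhSevenTerm n z) hM.hasSum fun n ↦ hMle n z
      rw [(h z hz).tsum_eq] at h1
      have h2 := hK z hz
      rw [abs_le] at h1 h2 ⊢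
      constructor <;> linarith
  simpa using h z hz

lemma integral_tanhSevenTerm (n : ℕ) :
    ∫ z in Set.Ioi 0, tanhSevenTerm n z =
      ∑ j : Fin 4, (tanhPole n ^ (2 * j.val + 7))⁻¹ *
        ∫ u in Set.Ioi 0, invOneAddSqComb (tanhSevenCoeff j) u := by
  have ha := tanhPole_pos n
  unfold tanhSevenTerm
  rw [integral_finsetSum _ fun j _ ↦ ((integrableOn_Ioi_comp_div
    (integrable_invOneAddSqComb (tanhSevenCoeff j)).integrableOn ha).const_mul _)]
  refine Finset.sum_congr rfl fun j _ ↦ ?_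
  rw [integral_const_mul, integral_Ioi_comp_div _ ha]
  rw [pow_succ _ (2 * j.val + 7)]
  field_simp

lemma integrableOn_tanhSevenTerm (n : ℕ) : IntegrableOn (tanhSevenTerm n) (Set.Ioi 0) :=
  integrable_finsetSum _ fun j _ ↦ ((integrableOn_Ioi_comp_div
    (integrable_invOneAddSqComb (tanhSevenCoeff j)).integrableOn (tanhPole_pos n)).const_mul _)

lemma summable_integral_norm_tanhSevenTerm :
    Summable fun n ↦ ∫ z in Set.Ioi 0, ‖tanhSevenTerm n z‖ := by
  refine Summable.of_nonneg_of_le (fun n ↦ integral_nonneg fun z ↦ norm_nonneg _) (fun n ↦ ?_)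
    (f := fun n ↦ ∑ j : Fin 4, (tanhPole n ^ (2 * j.val + 7))⁻¹ *
        ∫ u in Set.Ioi 0, |invOneAddSqComb (tanhSevenCoeff j) u|)
    (summable_sum fun j _ ↦ (summable_tanhPole_inv_pow (by lia)).mul_right _)
  have ha := tanhPole_pos n
  have hi (j : Fin 4) : IntegrableOn (fun z ↦ (tanhPole n ^ (2 * j.val + 8))⁻¹ *
      |invOneAddSqComb (tanhSevenCoeff j) (z / tanhPole n)|) (Set.Ioi 0) :=
    (integrableOn_Ioi_comp_div
      (integrable_invOneAddSqComb (tanhSevenCoeff j)).abs.integrableOn ha).const_mul _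
  have h1 : ∫ z in Set.Ioi 0, ‖tanhSevenTerm n z‖ ≤
      ∫ z in Set.Ioi 0, ∑ j : Fin 4, (tanhPole n ^ (2 * j.val + 8))⁻¹ *
        |invOneAddSqComb (tanhSevenCoeff j) (z / tanhPole n)| := by
    refine integral_mono (integrableOn_tanhSevenTerm n).norm
      (integrable_finsetSum _ fun j _ ↦ hi j) fun z ↦ ?_
    refine (Finset.abs_sum_le_sum_abs _ _).trans (Finset.sum_le_sum fun j _ ↦ ?_)
    rw [abs_mul, abs_of_nonneg (a := (tanhPole n ^ _)⁻¹) (by positivity)]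
  refine h1.trans_eq ?_
  rw [integral_finsetSum _ fun j _ ↦ hi j]
  refine Finset.sum_congr rfl fun j _ ↦ ?_
  rw [integral_const_mul,
    integral_Ioi_comp_div (fun u ↦ |invOneAddSqComb (tanhSevenCoeff j) u|) ha]
  rw [pow_succ _ (2 * j.val + 7)]
  field_simp

lemma integral_tanh_div_pow_seven :
    ∫ z in Set.Ioi (0 : ℝ), (Real.tanh z / z) ^ 7 =
      ∑ j : Fin 4, (∑' n, (tanhPole n ^ (2 * j.val + 7))⁻¹) *
        ∫ u in Set.Ioi 0, invOneAddSqComb (tanhSevenCoeff j) u := by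
  have h := hasSum_integral_of_summable_integral_norm integrableOn_tanhSevenTerm
    summable_integral_norm_tanhSevenTerm
  have h1 : ∫ z in Set.Ioi (0 : ℝ), (Real.tanh z / z) ^ 7 =
      ∫ z in Set.Ioi 0, ∑' n, tanhSevenTerm n z :=
    setIntegral_congr_fun measurableSet_Ioi fun z hz ↦ (hasSum_tanhSevenTerm hz).tsum_eq.symm
  rw [h1]
  refine h.unique ?_
  simp_rw [integral_tanhSevenTerm]
  exact hasSum_sum fun j _ ↦ (summable_tanhPole_inv_pow (by lia)).hasSum.mul_right _

theorem stmt_9 :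
    (↑(∫ z in Set.Ioi (0:ℝ), Real.tanh z ^ 7 / z ^ 7) : ℂ) = -127 * riemannZeta 7 / (π:ℂ) ^ 6 + 1402184 * riemannZeta 9 / (45 * (π:ℂ) ^ 8) - 1003030 * riemannZeta 11 / (π:ℂ) ^ 10 + 7568484 * riemannZeta 13 / (π:ℂ) ^ 12 := by
  have hp : (π : ℂ) ≠ 0 := by exact_mod_cast Real.pi_ne_zero
  have h7 := (summable_and_tsum_tanhPole_inv_pow (k := 7) (by norm_num)).2
  have h9 := (summable_and_tsum_tanhPole_inv_pow (k := 9) (by norm_num)).2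
  have h11 := (summable_and_tsum_tanhPole_inv_pow (k := 11) (by norm_num)).2
  have h13 := (summable_and_tsum_tanhPole_inv_pow (k := 13) (by norm_num)).2
  simp_rw [← div_pow]
  rw [integral_tanh_div_pow_seven, Fin.sum_univ_four]
  have i0 : ∫ u in Set.Ioi 0, invOneAddSqComb (tanhSevenCoeff 0) u = -π := by
    rw [integral_invOneAddSqComb]
    simp [Fin.sum_univ_succ, tanhSevenCoeff, Finset.prod_range_succ]
    ring
  have i1 : ∫ u in Set.Ioi 0, invOneAddSqComb (tanhSevenCoeff 1) u = 98 / 45 * 28 * π := by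
    rw [integral_invOneAddSqComb]
    simp [Fin.sum_univ_succ, tanhSevenCoeff, Finset.prod_range_succ]
    ring
  have i2 : ∫ u in Set.Ioi 0, invOneAddSqComb (tanhSevenCoeff 2) u = -490 * π := by
    rw [integral_invOneAddSqComb]
    simp [Fin.sum_univ_succ, tanhSevenCoeff, Finset.prod_range_succ]
    ring
  have i3 : ∫ u in Set.Ioi 0, invOneAddSqComb (tanhSevenCoeff 3) u = 924 * π := by
    rw [integral_invOneAddSqComb]
    simp [Fin.sum_univ_succ, tanhSevenCoeff, Finset.prod_range_succ]
    ring
  rw [i0, i1, i2, i3]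
  norm_num only [Fin.val_zero, Fin.val_one, Fin.val_two, Fin.coe_ofNat_eq_mod]
  push_cast at h7 h9 h11 h13 ⊢
  rw [h7, h9, h11, h13]
  field_simp
  ring
end
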